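/- arXiv:2205.11054 — 2 statements merged into one kernel-verified Lean document; each statement's English description precedes it below -/
import Mathlib

section
/- Let (T, F) be a pretorsion theory in a category C. If Z = T ∩ F is closed under quotients (for every epimorphism with domain in Z the codomain is in Z), then T is closed under quotients; if Z is closed under subobjects (for every monomorphism with codomain in Z the domain is in Z), then F is closed under subobjects. -/
/- Basic notions of pretorsion theories, after Borceux, Campanini, Gran,
"Pretorsion theories in lextensive categories". -/

namespace PretorsionPaper

open CategoryTheory CategoryTheory.Limits

universe w₂ w₁ v' u' v u

variable {C : Type u} [Category.{v} C]

/-- A morphism is `Z`-trivial if it factors through an object of `Z`. -/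
def IsTrivial (Z : Set C) {X Y : C} (f : X ⟶ Y) : Prop :=
  ∃ (W : C) (g : X ⟶ W) (h : W ⟶ Y), W ∈ Z ∧ g ≫ h = f

/-- `ε : K ⟶ A` is a `Z`-kernel of `f : A ⟶ B`. -/
structure IsZKernel (Z : Set C) {K A B : C} (ε : K ⟶ A) (f : A ⟶ B) : Prop where
  comp_trivial : IsTrivial Z (ε ≫ f)
  lift : ∀ {Y : C} (l : Y ⟶ A), IsTrivial Z (l ≫ f) → ∃! l' : Y ⟶ K, l' ≫ ε = l

/-- `q : B ⟶ Q` is a `Z`-cokernel of `f : A ⟶ B`. -/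
structure IsZCokernel (Z : Set C) {A B Q : C} (q : B ⟶ Q) (f : A ⟶ B) : Prop where
  comp_trivial : IsTrivial Z (f ≫ q)
  desc : ∀ {W : C} (h : B ⟶ W), IsTrivial Z (f ≫ h) → ∃! h' : Q ⟶ W, q ≫ h' = h

/-- A pretorsion theory `(T, F)` in a category `C`: two replete full subcategories
(given by their classes of objects) such that every morphism from `T` to `F` is
`Z`-trivial (`Z := T ∩ F`) and every object fits in a short `Z`-exact sequence
`T₀ ⟶ X ⟶ F₀` with `T₀ ∈ T`, `F₀ ∈ F`. -/
structure PretorsionTheory (C : Type u) [Category.{v} C] where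
  T : Set C
  F : Set C
  replete_T : ∀ {X Y : C}, (X ≅ Y) → X ∈ T → Y ∈ T
  replete_F : ∀ {X Y : C}, (X ≅ Y) → X ∈ F → Y ∈ F
  hom_trivial : ∀ {X Y : C}, X ∈ T → Y ∈ F → ∀ f : X ⟶ Y, IsTrivial (T ∩ F) f
  exact_seq : ∀ X : C, ∃ (T₀ F₀ : C) (e : T₀ ⟶ X) (h : X ⟶ F₀),
    T₀ ∈ T ∧ F₀ ∈ F ∧ IsZKernel (T ∩ F) e h ∧ IsZCokernel (T ∩ F) h e

/-- The class of trivial objects of a pretorsion theory. -/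
def PretorsionTheory.Z (P : PretorsionTheory C) : Set C := P.T ∩ P.F

lemma IsTrivial.precomp {Z : Set C} {X Y W : C} {f : X ⟶ Y} (hf : IsTrivial Z f) (g : W ⟶ X) :
    IsTrivial Z (g ≫ f) := by
  obtain ⟨V, a, b, hV, rfl⟩ := hf
  exact ⟨V, g ≫ a, b, hV, Category.assoc g a b⟩

lemma IsTrivial.postcomp {Z : Set C} {X Y W : C} {f : X ⟶ Y} (hf : IsTrivial Z f) (g : Y ⟶ W) :
    IsTrivial Z (f ≫ g) := by
  obtain ⟨V, a, b, hV, rfl⟩ := hf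
  exact ⟨V, a, b ≫ g, hV, (Category.assoc a b g).symm⟩

lemma IsTrivial.of_domain_mem {Z : Set C} {X Y : C} (hX : X ∈ Z) (f : X ⟶ Y) : IsTrivial Z f :=
  ⟨X, 𝟙 X, f, hX, Category.id_comp f⟩

lemma IsTrivial.of_codomain_mem {Z : Set C} {X Y : C} (hY : Y ∈ Z) (f : X ⟶ Y) : IsTrivial Z f :=
  ⟨Y, f, 𝟙 Y, hY, Category.comp_id f⟩

lemma IsZKernel.mono {Z : Set C} {K A B : C} {ε : K ⟶ A} {f : A ⟶ B} (h : IsZKernel Z ε f) :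
    Mono ε where
  right_cancellation a b hab := by
    have ht : IsTrivial Z ((b ≫ ε) ≫ f) := by
      rw [Category.assoc]
      exact h.comp_trivial.precomp b
    exact (h.lift (b ≫ ε) ht).unique hab rfl

lemma IsZCokernel.epi {Z : Set C} {A B Q : C} {q : B ⟶ Q} {f : A ⟶ B} (h : IsZCokernel Z q f) :
    Epi q where
  left_cancellation a b hab := by
    have ht : IsTrivial Z (f ≫ q ≫ b) := by
      rw [← Category.assoc]
      exact h.comp_trivial.postcomp b
    exact (h.desc (q ≫ b) ht).unique hab rfl

/-- A `Z`-kernel of a `Z`-trivial morphism is an isomorphism. -/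
lemma IsZKernel.isIso {Z : Set C} {K A B : C} {ε : K ⟶ A} {f : A ⟶ B} (h : IsZKernel Z ε f)
    (hf : IsTrivial Z f) : IsIso ε := by
  have := h.mono
  obtain ⟨s, hs, -⟩ := h.lift (𝟙 A) (hf.precomp _)
  exact ⟨s, by simp [← cancel_mono ε, hs], hs⟩

/-- A `Z`-cokernel of a `Z`-trivial morphism is an isomorphism. -/
lemma IsZCokernel.isIso {Z : Set C} {A B Q : C} {q : B ⟶ Q} {f : A ⟶ B} (h : IsZCokernel Z q f)
    (hf : IsTrivial Z f) : IsIso q := by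
  have := h.epi
  obtain ⟨s, hs, -⟩ := h.desc (𝟙 B) (hf.postcomp _)
  exact ⟨s, hs, by rw [← cancel_epi q, ← Category.assoc, hs, Category.id_comp,
    Category.comp_id]⟩

/-- if `Z` is closed under quotients then so is `T`; if `Z` is closed
under subobjects then so is `F`. -/
theorem closure_of_torsion_and_torsionFree_of_closure_of_trivial (P : PretorsionTheory C) :
    ((∀ {X Y : C} (e : X ⟶ Y), Epi e → X ∈ P.Z → Y ∈ P.Z) →
      ∀ {X Y : C} (e : X ⟶ Y), Epi e → X ∈ P.T → Y ∈ P.T) ∧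
    ((∀ {N X : C} (n : N ⟶ X), Mono n → X ∈ P.Z → N ∈ P.Z) →
      ∀ {N X : C} (n : N ⟶ X), Mono n → X ∈ P.F → N ∈ P.F) := by
  constructor
  · intro hZ X Y e he hX
    obtain ⟨T₀, F₀, ε, q, hT₀, hF₀, hker, hcoker⟩ := P.exact_seq Y
    obtain ⟨W, a, b, hW, hab⟩ := P.hom_trivial hX hF₀ (e ≫ q)
    have := hcoker.epi
    have : Epi (a ≫ b) := hab ▸ epi_comp e q
    have hF₀Z : F₀ ∈ P.T ∩ P.F := hZ b (epi_of_epi a b) hW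
    have := hker.isIso (.of_codomain_mem hF₀Z q)
    exact P.replete_T (asIso ε) hT₀
  · intro hZ N X n hn hX
    obtain ⟨T₀, F₀, ε, q, hT₀, hF₀, hker, hcoker⟩ := P.exact_seq N
    obtain ⟨W, a, b, hW, hab⟩ := P.hom_trivial hT₀ hX (ε ≫ n)
    have := hker.mono
    have : Mono (a ≫ b) := hab ▸ mono_comp ε n
    have hT₀Z : T₀ ∈ P.T ∩ P.F := hZ a (mono_of_mono a b) hW
    have := hcoker.isIso (.of_domain_mem hT₀Z ε)
    exact P.replete_F (asIso q).symm hF₀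

end PretorsionPaper
end

section
/- Let C be a lextensive category with a pretorsion theory (T, F) such that Z := T ∩ F is closed under binary coproducts and under complemented subobjects, and assume every morphism of C admits a Z-cokernel. Then the stable category Stab(C) has cokernels of all morphisms, and the functor Σ : C → Stab(C) sends Z-cokernels to cokernels: if q : Y → Q is a Z-cokernel of g : X → Y in C, then Σ(q) is a cokernel of Σ(g) in Stab(C). -/
/- Basic notions of pretorsion theories, after Borceux, Campanini, Gran,
"Pretorsion theories in lextensive categories". -/

namespace PretorsionPaper

open CategoryTheory CategoryTheory.Limits

universe w₂ w₁ v' u' v u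

variable {C : Type u} [Category.{v} C]

/-- A morphism `β : B ⟶ Y` is a coproduct coprojection (equivalently, exhibits `B` as a
complemented subobject of `Y`) if there are `B'` and `β' : B' ⟶ Y` making `Y` a
coproduct of `B` and `B'` with coprojections `β`, `β'`. -/
def IsCoprodInclusion {B Y : C} (β : B ⟶ Y) : Prop :=
  ∃ (B' : C) (β' : B' ⟶ Y), Nonempty (IsColimit (BinaryCofan.mk β β'))

/-- A representative of a partial morphism `X ⇀ Y`: a subobject-domain `dom` with an
inclusion `incl : dom ⟶ X` and a morphism `map : dom ⟶ Y`. -/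
structure ParHom (X Y : C) where
  dom : C
  incl : dom ⟶ X
  map : dom ⟶ Y

/-- A partial morphism representative is valid when its inclusion is a complemented
subobject (a coproduct coprojection). -/
def ParHom.IsValid {X Y : C} (p : ParHom X Y) : Prop := IsCoprodInclusion p.incl

/-- The total partial morphism associated with an ordinary morphism (this is the
action of the functor `I : C ⟶ Par(C)`, and `Σ f` is its congruence class). -/
def ParHom.ofHom {X Y : C} (f : X ⟶ Y) : ParHom X Y := ⟨X, 𝟙 X, f⟩

/-- Composition of partial morphism representatives, via the chosen pullback. -/
noncomputable def ParHom.comp [HasPullbacks C] {X Y W : C}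
    (p : ParHom X Y) (q : ParHom Y W) : ParHom X W where
  dom := pullback p.map q.incl
  incl := pullback.fst p.map q.incl ≫ p.incl
  map := pullback.snd p.map q.incl ≫ q.map

/-- The zero partial morphism `X ⇀ Y`, factoring through the initial object. -/
noncomputable def ParHom.zero [HasInitial C] (X Y : C) : ParHom X Y :=
  ⟨⊥_ C, initial.to X, initial.to Y⟩

/-- The congruence relation on partial morphism representatives: there is a common
complemented subobject `Cm` of the two domains (with complements `C₁`, `C₂`),
compatibly included in `X`, on which the two morphisms agree, and on the complements
the morphisms are `Z`-trivial. -/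
def ParEquiv (Z : Set C) {X Y : C} (p q : ParHom X Y) : Prop :=
  ∃ (Cm C₁ C₂ : C) (γ₁ : Cm ⟶ p.dom) (δ₁ : C₁ ⟶ p.dom) (γ₂ : Cm ⟶ q.dom) (δ₂ : C₂ ⟶ q.dom),
    Nonempty (IsColimit (BinaryCofan.mk γ₁ δ₁)) ∧
    Nonempty (IsColimit (BinaryCofan.mk γ₂ δ₂)) ∧
    γ₁ ≫ p.incl = γ₂ ≫ q.incl ∧
    γ₁ ≫ p.map = γ₂ ≫ q.map ∧
    IsTrivial Z (δ₁ ≫ p.map) ∧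
    IsTrivial Z (δ₂ ≫ q.map)

/-- `k : K ⇀ X` is a kernel of `f : X ⇀ Y` in the pointed stable category: the
composite is the zero morphism, and every (valid) partial morphism whose composite
with `f` is zero factors through `k`, uniquely up to congruence. -/
def IsStabKernel [HasPullbacks C] [HasInitial C] (Z : Set C) {K X Y : C}
    (k : ParHom K X) (f : ParHom X Y) : Prop :=
  ParEquiv Z (k.comp f) (ParHom.zero K Y) ∧
  ∀ {N : C} (p : ParHom N X), p.IsValid → ParEquiv Z (p.comp f) (ParHom.zero N Y) →
    ∃ u : ParHom N K, u.IsValid ∧ ParEquiv Z (u.comp k) p ∧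
      ∀ u' : ParHom N K, u'.IsValid → ParEquiv Z (u'.comp k) p → ParEquiv Z u' u

/-- `c : Y ⇀ Q` is a cokernel of `f : X ⇀ Y` in the pointed stable category. -/
def IsStabCokernel [HasPullbacks C] [HasInitial C] (Z : Set C) {X Y Q : C}
    (f : ParHom X Y) (c : ParHom Y Q) : Prop :=
  ParEquiv Z (f.comp c) (ParHom.zero X Q) ∧
  ∀ {W : C} (h : ParHom Y W), h.IsValid → ParEquiv Z (f.comp h) (ParHom.zero X W) →
    ∃ u : ParHom Q W, u.IsValid ∧ ParEquiv Z (c.comp u) h ∧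
      ∀ u' : ParHom Q W, u'.IsValid → ParEquiv Z (c.comp u') h → ParEquiv Z u' u

/-- The morphisms `a` and `b` are the coprojections of a binary coproduct. -/
def IsCoprodPair {A B X : C} (a : A ⟶ X) (b : B ⟶ X) : Prop :=
  Nonempty (IsColimit (BinaryCofan.mk a b))

namespace IsCoprodPair

variable {A B X : C} {a : A ⟶ X} {b : B ⟶ X}

lemma exists_desc (h : IsCoprodPair a b) {W : C} (f : A ⟶ W) (g : B ⟶ W) :
    ∃ k : X ⟶ W, a ≫ k = f ∧ b ≫ k = g :=
  let k := BinaryCofan.IsColimit.desc' h.some f g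
  ⟨k.1, k.2⟩

lemma hom_ext (h : IsCoprodPair a b) {W : C} {f g : X ⟶ W} (ha : a ≫ f = a ≫ g)
    (hb : b ≫ f = b ≫ g) : f = g :=
  BinaryCofan.IsColimit.hom_ext h.some ha hb

lemma of_exists_desc (hd : ∀ {W : C} (f : A ⟶ W) (g : B ⟶ W), ∃ k : X ⟶ W, a ≫ k = f ∧ b ≫ k = g)
    (he : ∀ {W : C} (f g : X ⟶ W), a ≫ f = a ≫ g → b ≫ f = b ≫ g → f = g) :
    IsCoprodPair a b := by
  choose d hd₁ hd₂ using @hd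
  exact ⟨BinaryCofan.IsColimit.mk _ (fun f g => d f g) (fun f g => hd₁ f g) (fun f g => hd₂ f g)
    (fun f g m hf hg => he _ _ (hf.trans (hd₁ f g).symm) (hg.trans (hd₂ f g).symm))⟩

lemma flip (h : IsCoprodPair a b) : IsCoprodPair b a :=
  of_exists_desc (fun f g => let ⟨k, h₁, h₂⟩ := h.exists_desc g f; ⟨k, h₂, h₁⟩)
    (fun _ _ h₁ h₂ => h.hom_ext h₂ h₁)

lemma of_isIso_isInitial {f : A ⟶ X} [IsIso f] {I : C} (hI : IsInitial I) (i : I ⟶ X) :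
    IsCoprodPair f i :=
  of_exists_desc (fun g _ => ⟨inv f ≫ g, by simp, hI.hom_ext _ _⟩)
    (fun _ _ h _ => (cancel_epi f).1 h)

lemma comp [HasBinaryCoproducts C] (h : IsCoprodPair a b) {D E : C} {d : D ⟶ A} {e : E ⟶ A}
    (h' : IsCoprodPair d e) : IsCoprodPair (d ≫ a) (coprod.desc (e ≫ a) b) := by
  refine of_exists_desc (fun f g => ?_) (fun f g h₁ h₂ => ?_)
  · obtain ⟨k, hk₁, hk₂⟩ := h'.exists_desc f (coprod.inl ≫ g)
    obtain ⟨l, hl₁, hl₂⟩ := h.exists_desc k (coprod.inr ≫ g)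
    exact ⟨l, by simp [hl₁, hk₁], coprod.hom_ext
      (by rw [coprod.inl_desc_assoc, Category.assoc, hl₁, hk₂]) (by rw [coprod.inr_desc_assoc, hl₂])⟩
  · refine h.hom_ext (h'.hom_ext (by simpa using h₁) ?_) ?_
    · simpa only [coprod.inl_desc_assoc, Category.assoc] using coprod.inl ≫= h₂
    · simpa only [coprod.inr_desc_assoc] using coprod.inr ≫= h₂

variable [FinitaryExtensive C]

lemma mono_left (h : IsCoprodPair a b) : Mono a :=
  FinitaryExtensive.mono_inl_of_isColimit h.some

lemma nonempty_isInitial (h : IsCoprodPair a b) {T : C} {x : T ⟶ A} {y : T ⟶ B}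
    (w : x ≫ a = y ≫ b) : Nonempty (IsInitial T) := by
  let t : T ⟶ ⊥_ C := (FinitaryExtensive.isPullback_initial_to_binaryCofan h.some).lift x y w
  have : IsIso t := initialIsInitial.isIso_to t
  exact ⟨initialIsInitial.ofIso (asIso t).symm⟩

lemma of_isPullback (h : IsCoprodPair a b) {X' A' B' : C} {f : X' ⟶ X} {a' : A' ⟶ X'}
    {b' : B' ⟶ X'} {fa : A' ⟶ A} {fb : B' ⟶ B} (ha : IsPullback a' fa f a)
    (hb : IsPullback b' fb f b) : IsCoprodPair a' b' :=
  ((BinaryCofan.isVanKampen_iff _).1 (FinitaryExtensive.vanKampen _ h.some)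
    (BinaryCofan.mk a' b') fa fb f ha.w.symm hb.w.symm).2 ⟨ha, hb⟩

lemma isPullback_left (h : IsCoprodPair a b) {X' A' B' : C} {f : X' ⟶ X} {a' : A' ⟶ X'}
    {b' : B' ⟶ X'} (h' : IsCoprodPair a' b') {fa : A' ⟶ A} {fb : B' ⟶ B}
    (ha : fa ≫ a = a' ≫ f) (hb : fb ≫ b = b' ≫ f) : IsPullback a' fa f a :=
  (((BinaryCofan.isVanKampen_iff _).1 (FinitaryExtensive.vanKampen _ h.some)
    (BinaryCofan.mk a' b') fa fb f ha hb).1 h').1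

lemma pullback [HasPullbacks C] (h : IsCoprodPair a b) {X' : C} (f : X' ⟶ X) :
    IsCoprodPair (pullback.fst f a) (pullback.fst f b) :=
  h.of_isPullback (IsPullback.of_hasPullback f a) (IsPullback.of_hasPullback f b)

/-- If a coproduct summand of `X` is contained in `D ↪ X`, it is a coproduct summand of `D`. -/
lemma restrict [HasPullbacks C] (h : IsCoprodPair a b) {D : C} {d : D ⟶ X} [Mono d] {a' : A ⟶ D}
    (ha' : a' ≫ d = a) : IsCoprodPair a' (pullback.fst d b) := by
  refine h.of_isPullback (f := d) (fa := 𝟙 A) ⟨⟨by simp [ha']⟩, ⟨?_⟩⟩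
    (IsPullback.of_hasPullback d b)
  refine PullbackCone.IsLimit.mk _ (fun s => s.snd) (fun s => ?_) (fun s => by simp)
    (fun s m _ hm => by simpa using hm)
  rw [← cancel_mono d, Category.assoc, ha', s.condition]

/-- A morphism disjoint from one summand of a coproduct factors through the other one. -/
lemma exists_lift_right [HasPullbacks C] (h : IsCoprodPair a b) {T : C} (f : T ⟶ X)
    (hf : Nonempty (IsInitial (Limits.pullback f a))) : ∃ l : T ⟶ B, l ≫ b = f := by
  obtain ⟨hI⟩ := hf
  obtain ⟨l, -, hl⟩ := (h.pullback f).exists_desc (hI.to B) (pullback.snd f b)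
  exact ⟨l, (h.pullback f).hom_ext (hI.hom_ext _ _)
    (by rw [← Category.assoc, hl, pullback.condition])⟩

lemma isIso_of_epi (h : IsCoprodPair a b) [Epi a] : IsIso a := by
  obtain ⟨k, hk₁, hk₂⟩ := h.exists_desc (a ≫ coprod.inl) (b ≫ (coprod.inr : X ⟶ X ⨿ X))
  have hk : k = coprod.inl := by rw [← cancel_epi a, hk₁]
  have hX : IsCoprodPair (coprod.inl : X ⟶ X ⨿ X) coprod.inr := ⟨coprodIsCoprod X X⟩
  obtain ⟨hB⟩ := hX.nonempty_isInitial (x := b) (y := b) (by rw [← hk₂, hk])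
  obtain ⟨l, hl, -⟩ := h.exists_desc (𝟙 A) (hB.to A)
  exact ⟨l, hl, by rw [← cancel_epi a, reassoc_of% hl, Category.comp_id]⟩

end IsCoprodPair

section Trivial

variable {Z : Set C}

lemma IsTrivial.comp_left {X Y W : C} {f : X ⟶ Y} (hf : IsTrivial Z f) (g : W ⟶ X) :
    IsTrivial Z (g ≫ f) := by
  obtain ⟨S, a, b, hS, rfl⟩ := hf
  exact ⟨S, g ≫ a, b, hS, by simp⟩

lemma IsTrivial.comp_right {X Y W : C} {f : X ⟶ Y} (hf : IsTrivial Z f) (g : Y ⟶ W) :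
    IsTrivial Z (f ≫ g) := by
  obtain ⟨S, a, b, hS, rfl⟩ := hf
  exact ⟨S, a, b ≫ g, hS, by simp⟩

lemma IsTrivial.of_isInitial {X Y I : C} {f : X ⟶ Y} (hf : IsTrivial Z f) (hI : IsInitial I)
    (t : I ⟶ Y) : IsTrivial Z t := by
  obtain ⟨S, a, b, hS, rfl⟩ := hf
  exact ⟨S, hI.to S, b, hS, hI.hom_ext _ _⟩

lemma IsTrivial.of_isCoprodPair_isInitial {A B X Y : C} {a : A ⟶ X} {b : B ⟶ X}
    (h : IsCoprodPair a b) (hA : IsInitial A) {f : X ⟶ Y} (hf : IsTrivial Z (b ≫ f)) :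
    IsTrivial Z f := by
  obtain ⟨S, s, t, hS, hst⟩ := hf
  obtain ⟨k, -, hk⟩ := h.exists_desc (hA.to S) s
  exact ⟨S, k, t, hS, h.hom_ext (hA.hom_ext _ _) (by rw [reassoc_of% hk, hst])⟩

lemma IsTrivial.of_isCoprodPair [HasBinaryCoproducts C]
    (hZ : ∀ A B : C, A ∈ Z → B ∈ Z → (A ⨿ B) ∈ Z) {A B X Y : C} {a : A ⟶ X} {b : B ⟶ X}
    (h : IsCoprodPair a b) {f : X ⟶ Y} (ha : IsTrivial Z (a ≫ f)) (hb : IsTrivial Z (b ≫ f)) :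
    IsTrivial Z f := by
  obtain ⟨S, s, t, hS, hst⟩ := ha
  obtain ⟨S', s', t', hS', hst'⟩ := hb
  obtain ⟨k, hk, hk'⟩ := h.exists_desc (s ≫ coprod.inl) (s' ≫ (coprod.inr : S' ⟶ S ⨿ S'))
  exact ⟨S ⨿ S', k, coprod.desc t t', hZ _ _ hS hS', h.hom_ext
    (by rw [reassoc_of% hk, coprod.inl_desc, hst])
    (by rw [reassoc_of% hk', coprod.inr_desc, hst'])⟩

lemma IsZCokernel.epi_s17 {A Y Q : C} {q : Y ⟶ Q} {g : A ⟶ Y} (hq : IsZCokernel Z q g) : Epi q :=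
  ⟨fun a b hab => (hq.desc (q ≫ a)
    (by simpa using hq.comp_trivial.comp_right a)).unique rfl hab.symm⟩

variable [FinitaryExtensive C]

lemma parEquiv_zero_iff {X Y : C} {p : ParHom X Y} :
    ParEquiv Z p (ParHom.zero X Y) ↔ IsTrivial Z p.map := by
  constructor
  · rintro ⟨Cm, C₁, C₂, γ₁, δ₁, γ₂, δ₂, h₁, -, -, -, h, -⟩
    have : IsIso γ₂ := initialIsInitial.isIso_to γ₂
    exact .of_isCoprodPair_isInitial h₁ (initialIsInitial.ofIso (asIso γ₂).symm) h
  · intro h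
    exact ⟨⊥_ C, p.dom, ⊥_ C, initial.to _, 𝟙 _, 𝟙 _, 𝟙 _,
      (IsCoprodPair.of_isIso_isInitial initialIsInitial _).flip,
      IsCoprodPair.of_isIso_isInitial (f := 𝟙 (⊥_ C)) initialIsInitial (𝟙 _),
      initialIsInitial.hom_ext _ _, initialIsInitial.hom_ext _ _, by simpa using h,
      h.of_isInitial initialIsInitial _⟩

variable [HasFiniteLimits C]

/-- A coproduct decomposition of the codomain of `g` induces one of its `Z`-cokernel. -/
lemma IsZCokernel.exists_isCoprodPair (hZ : ∀ A B : C, A ∈ Z → B ∈ Z → (A ⨿ B) ∈ Z)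
    (hcoker : ∀ {X Y : C} (g : X ⟶ Y), ∃ (Q : C) (q : Y ⟶ Q), IsZCokernel Z q g)
    {A Y Q : C} {q : Y ⟶ Q} {g : A ⟶ Y} (hq : IsZCokernel Z q g) {M N : C} {m : M ⟶ Y}
    {n : N ⟶ Y} (h : IsCoprodPair m n) :
    ∃ (QM QN : C) (qM : M ⟶ QM) (qN : N ⟶ QN) (jM : QM ⟶ Q) (jN : QN ⟶ Q),
      IsZCokernel Z qM (pullback.snd g m) ∧ qM ≫ jM = m ≫ q ∧ qN ≫ jN = n ≫ q ∧
      IsCoprodPair jM jN := by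
  obtain ⟨QM, qM, hM⟩ := hcoker (pullback.snd g m)
  obtain ⟨QN, qN, hN⟩ := hcoker (pullback.snd g n)
  obtain ⟨jM, hjM, -⟩ := hM.desc (m ≫ q) (by
    rw [← pullback.condition_assoc]; exact hq.comp_trivial.comp_left _)
  obtain ⟨jN, hjN, -⟩ := hN.desc (n ≫ q) (by
    rw [← pullback.condition_assoc]; exact hq.comp_trivial.comp_left _)
  have := hM.epi_s17
  have := hN.epi_s17
  have := hq.epi_s17
  refine ⟨QM, QN, qM, qN, jM, jN, hM, hjM, hjN, .of_exists_desc (fun {W} s t => ?_)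
    (fun s t hs ht => ?_)⟩
  · obtain ⟨k, hk₁, hk₂⟩ := h.exists_desc (qM ≫ s) (qN ≫ t)
    obtain ⟨d, hd, -⟩ := hq.desc k (by
      refine .of_isCoprodPair hZ (h.pullback g) ?_ ?_
      · rw [pullback.condition_assoc, hk₁, ← Category.assoc]
        exact hM.comp_trivial.comp_right s
      · rw [pullback.condition_assoc, hk₂, ← Category.assoc]
        exact hN.comp_trivial.comp_right t)
    exact ⟨d, by rw [← cancel_epi qM, reassoc_of% hjM, hd, hk₁],
      by rw [← cancel_epi qN, reassoc_of% hjN, hd, hk₂]⟩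
  · rw [← cancel_epi q]
    refine h.hom_ext ?_ ?_
    · rw [← reassoc_of% hjM, ← reassoc_of% hjM, hs]
    · rw [← reassoc_of% hjN, ← reassoc_of% hjN, ht]

/-- The restriction of a `Z`-cokernel to a coproduct summand of its codomain reflects triviality. -/
lemma IsZCokernel.isTrivial_of_isPullback (hZ : ∀ A B : C, A ∈ Z → B ∈ Z → (A ⨿ B) ∈ Z)
    {A Y Q : C} {q : Y ⟶ Q} {g : A ⟶ Y} (hq : IsZCokernel Z q g) {K K' S W : C} {k : K ⟶ Q}
    {k' : K' ⟶ Q} (hk : IsCoprodPair k k') {y : S ⟶ Y} {s : S ⟶ K} (sq : IsPullback y s q k)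
    {w : K ⟶ W} (hw : IsTrivial Z (s ≫ w)) : IsTrivial Z w := by
  obtain ⟨V, a, b, hV, hab⟩ := hw
  have := hq.epi_s17
  have hY : IsCoprodPair y (pullback.fst q k') :=
    hk.of_isPullback sq (IsPullback.of_hasPullback q k')
  obtain ⟨t, ht₁, ht₂⟩ := hY.exists_desc (a ≫ coprod.inl)
    (pullback.fst q k' ≫ q ≫ (coprod.inr : Q ⟶ V ⨿ Q))
  obtain ⟨l, hl, -⟩ := hq.desc t (by
    refine .of_isCoprodPair hZ (hY.pullback g) ?_ ?_
    · rw [pullback.condition_assoc, ht₁]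
      exact ⟨V, pullback.snd g y ≫ a, coprod.inl, hV, by simp⟩
    · rw [pullback.condition_assoc, ht₂, ← pullback.condition_assoc, ← Category.assoc g]
      exact (hq.comp_trivial.comp_right _).comp_left _)
  obtain ⟨r, hr₁, hr₂⟩ := hk.exists_desc (w ≫ coprod.inl) (k' ≫ (coprod.inr : Q ⟶ W ⨿ Q))
  have hlr : l ≫ coprod.map b (𝟙 Q) = r := by
    rw [← cancel_epi q]
    refine hY.hom_ext ?_ ?_
    · rw [reassoc_of% hl, reassoc_of% ht₁, coprod.inl_map, reassoc_of% hab, sq.w_assoc, hr₁]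
    · rw [reassoc_of% hl, reassoc_of% ht₂, coprod.inr_map, Category.id_comp,
        pullback.condition_assoc, pullback.condition_assoc, hr₂]
  have hW : IsCoprodPair (coprod.inl : W ⟶ W ⨿ Q) coprod.inr := ⟨coprodIsCoprod W Q⟩
  have sq' := hW.isPullback_left (f := coprod.map b (𝟙 Q)) (fa := b) (fb := 𝟙 Q)
    ⟨coprodIsCoprod V Q⟩ (by simp) (by simp)
  exact ⟨V, sq'.lift (k ≫ l) w (by rw [Category.assoc, hlr, hr₁]), b, hV, sq'.lift_snd _ _ _⟩

/-- Let `D` be a coproduct summand of the codomain of a `Z`-cokernel `q`, with preimage `S`, and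
let `QM` be a summand whose preimage `M` is a summand of `S`. If `v : D ⟶ W` becomes trivial on
the complement of `M` in `S`, then `QM` is a summand of `D`, and `v` is trivial on its
complement in `D`. -/
lemma IsZCokernel.exists_complement (hZ : ∀ A B : C, A ∈ Z → B ∈ Z → (A ⨿ B) ∈ Z)
    {A Y Q : C} {q : Y ⟶ Q} {g : A ⟶ Y} (hq : IsZCokernel Z q g)
    {M QM QN : C} {qM : M ⟶ QM} [Epi qM] {jM : QM ⟶ Q} {jN : QN ⟶ Q} (hj : IsCoprodPair jM jN)
    {D D' S E W : C} {d : D ⟶ Q} {d' : D' ⟶ Q} (hd : IsCoprodPair d d') {y : S ⟶ Y} {s : S ⟶ D}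
    (sq : IsPullback y s q d) {γ : M ⟶ S} {δ : E ⟶ S} (hγ : IsCoprodPair γ δ)
    (hM : qM ≫ jM = γ ≫ y ≫ q) {v : D ⟶ W} (hv : IsTrivial Z (δ ≫ s ≫ v)) :
    ∃ (K : C) (k : K ⟶ D) (a : QM ⟶ D), IsCoprodPair a k ∧ a ≫ d = jM ∧ IsTrivial Z (k ≫ v) := by
  have := hd.mono_left
  have hQM := hd.pullback jM
  have he : pullback.lift qM (γ ≫ s) (by rw [hM, Category.assoc, sq.w]) ≫
      pullback.fst jM d = qM := pullback.lift_fst _ _ _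
  have : Epi (pullback.fst jM d) := epi_of_epi_fac he
  have := hQM.isIso_of_epi
  obtain ⟨a, ha⟩ : ∃ a : QM ⟶ D, a ≫ d = jM :=
    ⟨inv (pullback.fst jM d) ≫ pullback.snd jM d, by simp [← pullback.condition]⟩
  refine ⟨pullback d jN, pullback.fst d jN, a, hj.restrict ha, ha, ?_⟩
  refine hq.isTrivial_of_isPullback hZ (hd.comp (hj.restrict ha).flip)
    (IsPullback.of_hasPullback q (pullback.fst d jN ≫ d)) ?_
  let f : pullback q (pullback.fst d jN ≫ d) ⟶ S :=
    sq.lift (pullback.fst _ _) (pullback.snd _ _ ≫ pullback.fst d jN)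
      (pullback.condition.trans (Category.assoc _ _ _).symm)
  have hfs : f ≫ s = pullback.snd _ _ ≫ pullback.fst d jN := sq.lift_snd _ _ _
  obtain ⟨l, hl⟩ := hγ.exists_lift_right f (hj.nonempty_isInitial
    (x := pullback.snd f γ ≫ qM)
    (y := pullback.fst f γ ≫ pullback.snd _ _ ≫ pullback.snd d jN) (by
      rw [Category.assoc, hM, ← pullback.condition_assoc, sq.w, reassoc_of% hfs]
      simp [pullback.condition]))
  rw [← Category.assoc, ← hfs, ← hl]
  simpa using hv.comp_left l

/-- The cokernel of a partial morphism in the stable category is represented by the `Z`-cokernel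
of its underlying map. -/
lemma IsZCokernel.isStabCokernel (hZ : ∀ A B : C, A ∈ Z → B ∈ Z → (A ⨿ B) ∈ Z)
    (hcoker : ∀ {X Y : C} (g : X ⟶ Y), ∃ (Q : C) (q : Y ⟶ Q), IsZCokernel Z q g)
    {X Y Q : C} {p : ParHom X Y} {q : Y ⟶ Q} (hq : IsZCokernel Z q p.map) :
    IsStabCokernel Z p (ParHom.ofHom q) := by
  refine ⟨parEquiv_zero_iff.2 ?_, ?_⟩
  · have h : pullback.snd p.map (𝟙 Y) = pullback.fst p.map (𝟙 Y) ≫ p.map := by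
      rw [pullback.condition, Category.comp_id]
    change IsTrivial Z (pullback.snd p.map (𝟙 Y) ≫ q)
    rw [h, Category.assoc]
    exact hq.comp_trivial.comp_left _
  rintro W ⟨B, β, h⟩ ⟨B', β', hβ⟩ hz
  change IsCoprodPair β β' at hβ
  replace hz : IsTrivial Z (pullback.snd p.map β ≫ h) := parEquiv_zero_iff.1 hz
  obtain ⟨QB, QB', qB, qB', jB, jB', hqB, hB, hB', hjB⟩ :=
    hq.exists_isCoprodPair hZ (fun g => hcoker g) hβ
  obtain ⟨h', hh', -⟩ := hqB.desc h hz
  have sqB : IsPullback β qB q jB := hjB.isPullback_left hβ hB hB'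
  refine ⟨⟨QB, jB, h'⟩, ⟨QB', jB', hjB⟩, ?_, ?_⟩
  · let φ : B ≅ pullback q jB := sqB.isoPullback
    refine ⟨B, ⊥_ C, ⊥_ C, φ.hom, initial.to _, 𝟙 B, initial.to _,
      IsCoprodPair.of_isIso_isInitial (X := pullback q jB) (f := φ.hom) initialIsInitial _,
      IsCoprodPair.of_isIso_isInitial (f := 𝟙 B) initialIsInitial _, ?_, ?_,
      hz.of_isInitial initialIsInitial _, hz.of_isInitial initialIsInitial _⟩
    · change φ.hom ≫ pullback.fst q jB ≫ 𝟙 Y = 𝟙 B ≫ β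
      simp [φ]
    · change φ.hom ≫ pullback.snd q jB ≫ h' = 𝟙 B ≫ h
      simp [φ, hh']
  · rintro ⟨D, d, v⟩ ⟨D', d', hd⟩ ⟨M, C₁, C₂, γ₁, δ₁, γ₂, δ₂, h₁, h₂, hi, hm, ht₁, ht₂⟩
    change IsCoprodPair d d' at hd
    change IsCoprodPair γ₁ δ₁ at h₁
    change IsCoprodPair γ₂ δ₂ at h₂
    change M ⟶ pullback q d at γ₁
    change C₁ ⟶ pullback q d at δ₁
    change M ⟶ B at γ₂
    change C₂ ⟶ B at δ₂
    change γ₁ ≫ pullback.fst q d ≫ 𝟙 Y = γ₂ ≫ β at hi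
    change γ₁ ≫ pullback.snd q d ≫ v = γ₂ ≫ h at hm
    change IsTrivial Z (δ₁ ≫ pullback.snd q d ≫ v) at ht₁
    change IsTrivial Z (δ₂ ≫ h) at ht₂
    rw [Category.comp_id] at hi
    obtain ⟨QM, QN, qM, qN, jM, jN, hqM, hM, -, hj⟩ :=
      hq.exists_isCoprodPair hZ (fun g => hcoker g) (hβ.comp h₂)
    have := hqM.epi_s17
    have := hd.mono_left
    have := hjB.mono_left
    obtain ⟨K, k, a, hak, ha, hk⟩ := hq.exists_complement hZ hj hd
      (IsPullback.of_hasPullback q d) h₁ (by rw [hM, ← hi, Category.assoc]) ht₁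
    obtain ⟨L, l, b, hbl, hb, hl⟩ := hq.exists_complement hZ hj hjB sqB h₂
      (by rw [hM, Category.assoc]) (v := h') (by rwa [hh'])
    refine ⟨QM, K, L, a, k, b, l, hak, hbl, ha.trans hb.symm, ?_, hk, hl⟩
    have hqa : qM ≫ a = γ₁ ≫ pullback.snd q d := by
      rw [← cancel_mono d, Category.assoc, ha, hM, ← hi, Category.assoc, Category.assoc,
        pullback.condition]
    have hqb : qM ≫ b = γ₂ ≫ qB := by
      rw [← cancel_mono jB, Category.assoc, hb, hM, Category.assoc, Category.assoc, hB]
    change a ≫ v = b ≫ h'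
    rw [← cancel_epi qM, reassoc_of% hqa, hm, reassoc_of% hqb, hh']

end Trivial

/-- if every morphism of `C` admits a `Z`-cokernel, then the stable
category has all cokernels and `Σ` sends `Z`-cokernels to cokernels. -/
theorem stab_has_cokernels_and_sigma_sends_zcokernels_to_cokernels
    [FinitaryExtensive C] [HasFiniteLimits C] (P : PretorsionTheory C)
    (hZcoprod : ∀ A B : C, A ∈ P.Z → B ∈ P.Z → (A ⨿ B) ∈ P.Z)
    (hZcompl : ∀ A B : C, (A ⨿ B) ∈ P.Z → A ∈ P.Z ∧ B ∈ P.Z)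
    (hcoker : ∀ {X Y : C} (g : X ⟶ Y), ∃ (Q : C) (q : Y ⟶ Q), IsZCokernel P.Z q g) :
    (∀ {X Y : C} (p : ParHom X Y), p.IsValid →
      ∃ (Q : C) (c : ParHom Y Q), c.IsValid ∧ IsStabCokernel P.Z p c) ∧
    (∀ {X Y Q : C} (g : X ⟶ Y) (q : Y ⟶ Q), IsZCokernel P.Z q g →
      IsStabCokernel P.Z (ParHom.ofHom g) (ParHom.ofHom q)) := by
  refine ⟨fun {X Y} p _ => ?_, fun {X Y Q} g q hq =>
    IsZCokernel.isStabCokernel hZcoprod (fun g => hcoker g) hq⟩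
  obtain ⟨Q, q, hq⟩ := hcoker p.map
  exact ⟨Q, ParHom.ofHom q,
    ⟨⊥_ C, initial.to Y, IsCoprodPair.of_isIso_isInitial (f := 𝟙 Y) initialIsInitial _⟩,
    hq.isStabCokernel hZcoprod (fun g => hcoker g)⟩
end PretorsionPaper
end
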